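/- Under the stated setup, the matrix identity Qᴴ Q = Aᴴ (M + Mᴴ) A − Aᴴ Mᴴ D₂ M A holds, where Qᴴ denotes the conjugate transpose of Q. -/

import Mathlib

open Matrix
open scoped ComplexOrder

/-- Under the stated setup, `Qᴴ Q = Aᴴ (M + Mᴴ) A − Aᴴ Mᴴ D₂ M A`. -/
theorem stmt_0 (n p : ℕ) (hn : 1 ≤ n) (hp : 1 ≤ p) (γ : ℝ) (hγ : 0 < γ)
    (A : Matrix (Fin p) (Fin n) ℂ) (D L : Matrix (Fin p) (Fin p) ℂ)
    (hD : D.IsHermitian)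
    (hsplit : (γ : ℂ) • (1 : Matrix (Fin p) (Fin p) ℂ) + A * Aᴴ = D + L + Lᴴ)
    (hDL : IsUnit (D + L))
    (D₂ : Matrix (Fin p) (Fin p) ℂ)
    (hD₂def : D₂ = D + (γ : ℂ) • (1 : Matrix (Fin p) (Fin p) ℂ))
    (hD₂ : D₂.PosDef)
    (M : Matrix (Fin p) (Fin p) ℂ) (hM : M = (D + L)⁻¹)
    (Q : Matrix (Fin n) (Fin n) ℂ) (hQ : Q = Aᴴ * M * A) :
    Qᴴ * Q = Aᴴ * (M + Mᴴ) * A - Aᴴ * Mᴴ * D₂ * M * A := by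
  have hNM : (D + L) * M = 1 := by
    rw [hM, mul_nonsing_inv _ ((isUnit_iff_isUnit_det _).mp hDL)]
  have hMN : Mᴴ * (D + L)ᴴ = 1 := by
    rw [← conjTranspose_mul, hNM, conjTranspose_one]
  have hAA : A * Aᴴ = (D + L) + (D + L)ᴴ - D₂ := by
    rw [conjTranspose_add, hD.eq, hD₂def, eq_sub_of_add_eq' hsplit]
    abel
  have hcore : Mᴴ * (A * Aᴴ) * M = M + Mᴴ - Mᴴ * D₂ * M := by
    rw [hAA, mul_sub, mul_add, sub_mul, add_mul, hMN, one_mul, mul_assoc Mᴴ (D + L), hNM,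
      mul_one, add_comm Mᴴ]
  calc Qᴴ * Q = Aᴴ * (Mᴴ * (A * Aᴴ) * M) * A := by
        simp only [hQ, conjTranspose_mul, conjTranspose_conjTranspose, Matrix.mul_assoc]
    _ = Aᴴ * (M + Mᴴ) * A - Aᴴ * Mᴴ * D₂ * M * A := by
        rw [hcore, Matrix.mul_sub, Matrix.sub_mul]
        simp only [Matrix.mul_assoc]
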